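/- Let (G, I) be a 3-transposition group with I a single conjugacy class generating G, and suppose the graph on I (with i ∼ j iff |ij| = 3) is k-regular with kα + 4 ≠ 0. Then the element ω := (4/(kα+4)) · Σ_{i∈I} xⁱ of the Matsuo algebra B_{α,β}(G) satisfies ω·xⁱ = 2xⁱ for every i ∈ I; hence ω/2 is a unity of B_{α,β}(G). -/

import Mathlib

theorem matsuo_finOrder {G : Type*} [Group G] (I : Finset G)
    (hconj : ∀ g : G, ∀ i ∈ I, g * i * g⁻¹ ∈ I)
    (hinv : ∀ i ∈ I, i * i = 1) (i j : G) (hi : i ∈ I) (hj : j ∈ I) :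
    0 < orderOf (i * j) := by
  have hi2 := hinv i hi
  have hj2 := hinv j hj
  have hii : i⁻¹ = i := inv_eq_of_mul_eq_one_left hi2
  have hjj : j⁻¹ = j := inv_eq_of_mul_eq_one_left hj2
  have key : ∀ m : ℕ, (i * j) ^ m * i * ((i * j) ^ m)⁻¹ = (i * j) ^ (2 * m) * i := by
    intro m
    have h1 : i * ((i * j) ^ m)⁻¹ * i⁻¹ = (i * j) ^ m := by
      rw [← inv_pow, ← conj_pow]
      congr 1
      simp [mul_inv_rev, hii, hjj, mul_assoc, hi2]
    have h2 : i * ((i * j) ^ m)⁻¹ = (i * j) ^ m * i := by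
      exact mul_inv_eq_iff_eq_mul.mp h1
    rw [mul_assoc, h2, two_mul, pow_add, mul_assoc]
  obtain ⟨a, b, hab, h⟩ := Finite.exists_ne_map_eq_of_infinite
    (fun m : ℕ => (⟨(i * j) ^ m * i * ((i * j) ^ m)⁻¹, hconj _ i hi⟩ : {g // g ∈ I}))
  have h' := congrArg Subtype.val h
  simp only [key] at h'
  have h'' := mul_right_cancel h'
  by_contra h0
  have h0' : orderOf (i * j) = 0 := by omega
  have hinj := injective_pow_iff_not_isOfFinOrder.mpr (orderOf_eq_zero_iff.mp h0')
  have := hinj h''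
  omega

/-- If (G, I) is an indecomposable 3-transposition group whose diagram is k-regular
with kα + 4 ≠ 0, then ω = (4/(kα+4)) Σᵢ xⁱ satisfies ωxⁱ = 2xⁱ for all i, and
ω/2 is a unity of the Matsuo algebra. -/
theorem matsuo_unity
    {G : Type*} [Group G] (I : Finset G) (α β : ℝ) (k : ℕ)
    (hconj : ∀ g : G, ∀ i ∈ I, g * i * g⁻¹ ∈ I)
    (hinv : ∀ i ∈ I, orderOf i = 2)
    (h3 : ∀ i ∈ I, ∀ j ∈ I, orderOf (i * j) ≤ 3)
    (hgen : Subgroup.closure (I : Set G) = ⊤)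
    (hsingle : ∀ i ∈ I, ∀ j ∈ I, IsConj i j)
    (hreg : ∀ i ∈ I, {j ∈ (I : Set G) | orderOf (i * j) = 3}.ncard = k)
    (hk : k * α + 4 ≠ 0)
    {B : Type*} [AddCommGroup B] [Module ℝ B]
    (mul : B →ₗ[ℝ] B →ₗ[ℝ] B) (x : G → B)
    (hcomm : ∀ u v : B, mul u v = mul v u)
    (hspan : Submodule.span ℝ (x '' (I : Set G)) = ⊤)
    (hsq : ∀ i ∈ I, mul (x i) (x i) = (2 : ℝ) • x i)
    (hord3 : ∀ i ∈ I, ∀ j ∈ I, orderOf (i * j) = 3 →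
      mul (x i) (x j) = (α / 2) • (x i + x j - x (i * j * i⁻¹)))
    (hcomm0 : ∀ i ∈ I, ∀ j ∈ I, i ≠ j → i * j = j * i → mul (x i) (x j) = 0) :
    (∀ i ∈ I, mul ((4 / (k * α + 4)) • ∑ j ∈ I, x j) (x i) = (2 : ℝ) • x i) ∧
    (∀ v : B, mul ((2 : ℝ)⁻¹ • (4 / (k * α + 4)) • ∑ j ∈ I, x j) v = v) := by
  classical
  have hinv' : ∀ i ∈ I, i * i = 1 := by
    intro i hi
    rw [← pow_two, ← hinv i hi, pow_orderOf_eq_one]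
  have hinv'' : ∀ i ∈ I, i⁻¹ = i := fun i hi => inv_eq_of_mul_eq_one_left (hinv' i hi)
  have main : ∀ i ∈ I, mul (x i) (∑ j ∈ I, x j) = (2 + k * α / 2 : ℝ) • x i := by
    intro i hi
    have hcard : (I.filter (fun j => orderOf (i * j) = 3)).card = k := by
      rw [← hreg i hi, ← Set.ncard_coe_finset]
      congr 1
      ext j
      simp
    have hterm : ∀ j ∈ I, mul (x i) (x j) = (if j = i then (2 : ℝ) • x i else 0) +
        (if orderOf (i * j) = 3 then (α / 2) • (x i + x j - x (i * j * i⁻¹)) else 0) := by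
      intro j hj
      by_cases hji : j = i
      · subst hji
        simp [hinv' j hj, hsq j hj]
      · by_cases h : orderOf (i * j) = 3
        · simp [hji, h, hord3 i hi j hj h]
        · rw [if_neg hji, if_neg h, add_zero]
          apply hcomm0 i hi j hj (Ne.symm hji)
          have hp := matsuo_finOrder I hconj hinv' i j hi hj
          have hle := h3 i hi j hj
          have hsqr : (i * j) ^ 2 = 1 := by
            apply orderOf_dvd_iff_pow_eq_one.mp
            have : orderOf (i * j) = 1 ∨ orderOf (i * j) = 2 := by omega
            rcases this with h | h <;> simp [h]
          have h4 : (i * j)⁻¹ = i * j := inv_eq_of_mul_eq_one_left (by rw [← pow_two, hsqr])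
          rw [← h4, mul_inv_rev, hinv'' i hi, hinv'' j hj]
    have hre : ∑ j ∈ I with orderOf (i * j) = 3, x (i * j * i⁻¹) =
        ∑ j ∈ I with orderOf (i * j) = 3, x j := by
      have hmem : ∀ j ∈ I.filter (fun j => orderOf (i * j) = 3),
          i * j * i⁻¹ ∈ I.filter (fun j => orderOf (i * j) = 3) := by
        intro j hj
        rw [Finset.mem_filter] at hj ⊢
        refine ⟨hconj i j hj.1, ?_⟩
        have : i * (i * j * i⁻¹) = i * (i * j) * i⁻¹ := by group
        rw [this, ← MulAut.conj_apply, MulEquiv.orderOf_eq, hj.2]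
      have hinvol : ∀ j, i * (i * j * i⁻¹) * i⁻¹ = j := by
        intro j
        have : i * (i * j * i⁻¹) * i⁻¹ = (i * i) * j * (i * i)⁻¹ := by group
        rw [this, hinv' i hi]; simp
      exact Finset.sum_bij' (fun j _ => i * j * i⁻¹) (fun j _ => i * j * i⁻¹)
        hmem hmem (fun j _ => hinvol j) (fun j _ => hinvol j) (fun j _ => rfl)
    rw [map_sum, Finset.sum_congr rfl hterm, Finset.sum_add_distrib, Finset.sum_ite_eq',
      if_pos hi, ← Finset.sum_filter, ← Finset.smul_sum, Finset.sum_sub_distrib,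
      Finset.sum_add_distrib, hre, add_sub_cancel_right, Finset.sum_const, hcard,
      ← Nat.cast_smul_eq_nsmul ℝ, smul_smul, ← add_smul]
    congr 1
    ring
  have first : ∀ i ∈ I, mul ((4 / (k * α + 4)) • ∑ j ∈ I, x j) (x i) = (2 : ℝ) • x i := by
    intro i hi
    rw [hcomm, map_smul, main i hi, smul_smul]
    congr 1
    field_simp
    ring
  refine ⟨first, ?_⟩
  have hext : mul ((2 : ℝ)⁻¹ • (4 / (k * α + 4)) • ∑ j ∈ I, x j) = LinearMap.id := by
    apply LinearMap.ext_on hspan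
    rintro _ ⟨i, hi, rfl⟩
    rw [map_smul, LinearMap.smul_apply, first i hi, smul_smul]
    simp
  intro v
  rw [hext, LinearMap.id_apply]
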